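/- Let Â and A be real n×n matrices, P a symmetric positive definite real n×n matrix, and Δ a symmetric positive definite real n×n matrix such that −Δ − (Â·P·Âᵀ − P) is positive semidefinite (i.e., Â·P·Âᵀ − P ≼ −Δ). If d := ‖A − Â‖₂ satisfies d·(2‖Â·P‖₂ + d·‖P‖₂) < λ_min(Δ), then P − A·P·Aᵀ is positive definite. -/

import Mathlib

open Matrix

/-- The spectral norm (ℓ²→ℓ² operator norm) of a real matrix. -/
noncomputable def specNorm {m n : Type*} [Fintype m] [Fintype n] [DecidableEq n]
    (A : Matrix m n ℝ) : ℝ :=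
  ‖LinearMap.toContinuousLinearMap (Matrix.toEuclideanLin A)‖

/-- The smallest eigenvalue of a (Hermitian/symmetric) real matrix; junk value `0`
if the matrix is not Hermitian. -/
noncomputable def lamMin {n : Type*} [Fintype n] [DecidableEq n]
    (S : Matrix n n ℝ) : ℝ :=
  if h : S.IsHermitian then ⨅ i, h.eigenvalues i else 0

section SpectralNorm

open scoped Matrix.Norms.L2Operator

theorem specNorm_nonneg {m n : Type*} [Fintype m] [Fintype n] [DecidableEq n]
    (A : Matrix m n ℝ) : 0 ≤ specNorm A := norm_nonneg _

theorem specNorm_mul_le {l m n : Type*} [Fintype l] [Fintype m] [Fintype n] [DecidableEq m]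
    [DecidableEq n] (A : Matrix l m ℝ) (B : Matrix m n ℝ) :
    specNorm (A * B) ≤ specNorm A * specNorm B :=
  Matrix.l2_opNorm_mul A B

theorem specNorm_transpose {m n : Type*} [Fintype m] [Fintype n] [DecidableEq m] [DecidableEq n]
    (A : Matrix m n ℝ) : specNorm Aᵀ = specNorm A := by
  rw [← Matrix.conjTranspose_eq_transpose_of_trivial]
  exact Matrix.l2_opNorm_conjTranspose A

theorem dotProduct_mulVec_le_specNorm {n : Type*} [Fintype n] [DecidableEq n]
    (M : Matrix n n ℝ) (x : n → ℝ) : x ⬝ᵥ (M *ᵥ x) ≤ specNorm M * (x ⬝ᵥ x) := by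
  have hx : x ⬝ᵥ x = ‖WithLp.toLp 2 x‖ * ‖WithLp.toLp 2 x‖ := by
    rw [← real_inner_self_eq_norm_mul_norm, EuclideanSpace.inner_toLp_toLp]
    simp
  have hinner : x ⬝ᵥ (M *ᵥ x) = inner ℝ (WithLp.toLp 2 x) (WithLp.toLp 2 (M *ᵥ x)) := by
    rw [EuclideanSpace.inner_toLp_toLp, dotProduct_comm]
    simp
  have hM : ‖WithLp.toLp 2 (M *ᵥ x)‖ ≤ specNorm M * ‖WithLp.toLp 2 x‖ :=
    Matrix.l2_opNorm_mulVec M (WithLp.toLp 2 x)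
  rw [hinner, hx]
  calc _ ≤ ‖WithLp.toLp 2 x‖ * ‖WithLp.toLp 2 (M *ᵥ x)‖ := real_inner_le_norm _ _
    _ ≤ ‖WithLp.toLp 2 x‖ * (specNorm M * ‖WithLp.toLp 2 x‖) := by gcongr
    _ = _ := by ring

end SpectralNorm

theorem lamMin_mul_le_dotProduct_mulVec {n : Type*} [Fintype n] [DecidableEq n]
    {S : Matrix n n ℝ} (hS : S.IsHermitian) (x : n → ℝ) :
    lamMin S * (x ⬝ᵥ x) ≤ x ⬝ᵥ (S *ᵥ x) := by
  have hH : (S - algebraMap ℝ (Matrix n n ℝ) (lamMin S)).IsHermitian := by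
    refine hS.sub ?_
    rw [Algebra.algebraMap_eq_smul_one, Matrix.IsHermitian, Matrix.conjTranspose_smul]
    simp
  have hpos : (S - algebraMap ℝ (Matrix n n ℝ) (lamMin S)).PosSemidef := by
    refine hH.posSemidef_iff_eigenvalues_nonneg.mpr fun i => ?_
    have hmem := hH.eigenvalues_mem_spectrum_real i
    rw [← spectrum.sub_singleton_eq, Set.mem_sub] at hmem
    obtain ⟨a, ha, b, rfl, hab⟩ := hmem
    rw [hS.spectrum_real_eq_range_eigenvalues] at ha
    obtain ⟨j, rfl⟩ := ha
    have hmin : lamMin S ≤ hS.eigenvalues j := by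
      rw [lamMin, dif_pos hS]
      exact ciInf_le (Set.finite_range _).bddBelow j
    rw [← hab]
    exact sub_nonneg.mpr hmin
  have h := hpos.dotProduct_mulVec_nonneg x
  rw [Algebra.algebraMap_eq_smul_one, Matrix.sub_mulVec, Matrix.smul_mulVec, Matrix.one_mulVec,
    dotProduct_sub, dotProduct_smul, star_trivial, smul_eq_mul] at h
  linarith

/-- robustness of the Lyapunov inequality. If `Â·P·Âᵀ − P ≼ −Δ` with
`P, Δ` symmetric positive definite, and `d = ‖A − Â‖₂` satisfies
`d·(2‖Â·P‖₂ + d·‖P‖₂) < λ_min(Δ)`, then `P − A·P·Aᵀ` is positive definite. -/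
theorem stmt14 {n : ℕ} (Ahat A : Matrix (Fin n) (Fin n) ℝ)
    (P : Matrix (Fin n) (Fin n) ℝ) (hP : P.PosDef)
    (Δ : Matrix (Fin n) (Fin n) ℝ) (hΔ : Δ.PosDef)
    (hLyap : (-Δ - (Ahat * P * Ahatᵀ - P)).PosSemidef)
    (hd : specNorm (A - Ahat) * (2 * specNorm (Ahat * P) +
        specNorm (A - Ahat) * specNorm P) < lamMin Δ) :
    (P - A * P * Aᵀ).PosDef := by
  have hPt : Pᵀ = P := by
    simpa [Matrix.conjTranspose_eq_transpose_of_trivial] using hP.isHermitian.eq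
  have hH : (P - A * P * Aᵀ).IsHermitian := by
    simp [Matrix.IsHermitian, Matrix.conjTranspose_eq_transpose_of_trivial, hPt, Matrix.mul_assoc]
  refine Matrix.PosDef.of_dotProduct_mulVec_pos hH fun x hx => ?_
  rw [star_trivial]
  set D := A - Ahat with hD
  have hdecomp : P - A * P * Aᵀ = (-Δ - (Ahat * P * Ahatᵀ - P)) + Δ -
      (Ahat * P * Dᵀ + (Ahat * P * Dᵀ)ᵀ + D * P * Dᵀ) := by
    have hA : A = Ahat + D := by rw [hD]; abel
    rw [hA]
    simp only [Matrix.transpose_add, Matrix.transpose_mul, Matrix.transpose_transpose, hPt,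
      Matrix.add_mul, Matrix.mul_add, Matrix.mul_assoc]
    abel
  have hcross : specNorm (Ahat * P * Dᵀ) ≤ specNorm (Ahat * P) * specNorm D := by
    simpa only [specNorm_transpose] using specNorm_mul_le (Ahat * P) Dᵀ
  have hquad : specNorm (D * P * Dᵀ) ≤ specNorm D * specNorm P * specNorm D := by
    have h := specNorm_mul_le (D * P) Dᵀ
    rw [specNorm_transpose] at h
    exact h.trans (mul_le_mul_of_nonneg_right (specNorm_mul_le D P) (specNorm_nonneg D))
  have hxx : 0 < x ⬝ᵥ x := by simpa using Matrix.dotProduct_star_self_pos_iff.mpr hx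
  have h₁ := hLyap.dotProduct_mulVec_nonneg x
  have h₂ := lamMin_mul_le_dotProduct_mulVec hΔ.isHermitian x
  have h₃ := dotProduct_mulVec_le_specNorm (Ahat * P * Dᵀ) x
  have h₄ := dotProduct_mulVec_le_specNorm (Ahat * P * Dᵀ)ᵀ x
  have h₅ := dotProduct_mulVec_le_specNorm (D * P * Dᵀ) x
  rw [specNorm_transpose] at h₄
  rw [star_trivial] at h₁
  have h₆ := mul_le_mul_of_nonneg_right hcross hxx.le
  have h₇ := mul_le_mul_of_nonneg_right hquad hxx.le
  have h₈ := mul_lt_mul_of_pos_right hd hxx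
  rw [hdecomp, Matrix.sub_mulVec, Matrix.add_mulVec _ Δ, Matrix.add_mulVec _ (D * P * Dᵀ),
    Matrix.add_mulVec (Ahat * P * Dᵀ), dotProduct_sub, dotProduct_add, dotProduct_add,
    dotProduct_add]
  linarith
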